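/- The "V"-shaped symmetric GDoF of the (1,1,2,1) channel: for all real α ≥ 0, with M_1 = 1, N_1 = 1, M_2 = 2, N_2 = 1 and exponents (1,α,α,1), the symmetric GDoF satisfies d_sym((1,1,2,1),(1,α,α,1)) = 1−α/2 for 0 ≤ α ≤ 1; = α/2 for 1 ≤ α ≤ 2; and = 1 for α ≥ 2. -/

import Mathlib

/-- The two-pair function `f(u,(a₁,u₁),(a₂,u₂))`. -/
noncomputable def fFun (u : ℝ) (p q : ℝ × ℝ) : ℝ :=
  if q.1 ≤ p.1 then min u p.2 * p.1 + min (max (u - p.2) 0) q.2 * q.1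
  else min u q.2 * q.1 + min (max (u - q.2) 0) p.2 * p.1

/-- The three-pair expression evaluated in the given order. -/
noncomputable def gAux (u : ℝ) (p q r : ℝ × ℝ) : ℝ :=
  min u p.2 * p.1 + min (max (u - p.2) 0) q.2 * q.1
    + min (max (u - p.2 - q.2) 0) r.2 * r.1

/-- The three-pair function `g`, defined by sorting the pairs in
nonincreasing order of their first components. -/
noncomputable def gFun (u : ℝ) (p q r : ℝ × ℝ) : ℝ :=
  if q.1 ≤ p.1 then
    if r.1 ≤ q.1 then gAux u p q r
    else if r.1 ≤ p.1 then gAux u p r q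
    else gAux u r p q
  else
    if r.1 ≤ p.1 then gAux u q p r
    else if r.1 ≤ q.1 then gAux u q r p
    else gAux u r q p

/-- The GDoF region `D_o((M₁,N₁,M₂,N₂),(1,α₁₂,α₂₁,α₂₂))` of the 2-user MIMO
interference channel (Theorem 1). -/
noncomputable def GDoF (M1 N1 M2 N2 : ℕ) (a12 a21 a22 : ℝ) : Set (ℝ × ℝ) :=
  { d : ℝ × ℝ |
    0 ≤ d.1 ∧ 0 ≤ d.2 ∧
    d.1 ≤ min (M1 : ℝ) (N1 : ℝ) ∧
    d.2 ≤ min (M2 : ℝ) (N2 : ℝ) ∧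
    d.1 + a22 * d.2 ≤
      fFun (N2 : ℝ) (a12, (M1 : ℝ)) (a22, (M2 : ℝ)) +
      fFun (N1 : ℝ) (max (1 - a12) 0, min (M1 : ℝ) (N2 : ℝ)) (1, max ((M1 : ℝ) - (N2 : ℝ)) 0) ∧
    d.1 + a22 * d.2 ≤
      fFun (N1 : ℝ) (a21, (M2 : ℝ)) (1, (M1 : ℝ)) +
      fFun (N2 : ℝ) (max (a22 - a21) 0, min (M2 : ℝ) (N1 : ℝ)) (a22, max ((M2 : ℝ) - (N1 : ℝ)) 0) ∧
    d.1 + a22 * d.2 ≤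
      gFun (N1 : ℝ) (a21, (M2 : ℝ)) (max (1 - a12) 0, min (M1 : ℝ) (N2 : ℝ))
        (1, max ((M1 : ℝ) - (N2 : ℝ)) 0) +
      gFun (N2 : ℝ) (a12, (M1 : ℝ)) (max (a22 - a21) 0, min (M2 : ℝ) (N1 : ℝ))
        (a22, max ((M2 : ℝ) - (N1 : ℝ)) 0) ∧
    2 * d.1 + a22 * d.2 ≤
      fFun (N1 : ℝ) (a21, (M2 : ℝ)) (1, (M1 : ℝ)) +
      fFun (N1 : ℝ) (max (1 - a12) 0, min (M1 : ℝ) (N2 : ℝ)) (1, max ((M1 : ℝ) - (N2 : ℝ)) 0) +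
      gFun (N2 : ℝ) (a12, (M1 : ℝ)) (max (a22 - a21) 0, min (M2 : ℝ) (N1 : ℝ))
        (a22, max ((M2 : ℝ) - (N1 : ℝ)) 0) ∧
    d.1 + 2 * a22 * d.2 ≤
      fFun (M2 : ℝ) (a21, (N1 : ℝ)) (a22, (N2 : ℝ)) +
      fFun (N2 : ℝ) (max (a22 - a21) 0, min (M2 : ℝ) (N1 : ℝ)) (a22, max ((M2 : ℝ) - (N1 : ℝ)) 0) +
      gFun (N1 : ℝ) (a21, (M2 : ℝ)) (max (1 - a12) 0, min (M1 : ℝ) (N2 : ℝ))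
        (1, max ((M1 : ℝ) - (N2 : ℝ)) 0) }

/-- The symmetric GDoF `d_sym = sup { d ≥ 0 : (d,d) ∈ D_o }`. -/
noncomputable def dsym (M1 N1 M2 N2 : ℕ) (a12 a21 a22 : ℝ) : ℝ :=
  sSup { d : ℝ | 0 ≤ d ∧ (d, d) ∈ GDoF M1 N1 M2 N2 a12 a21 a22 }

/-- A two-pair function with a first pair wide enough to fill the budget takes the larger level. -/
theorem fFun_one_left (a b v : ℝ) (hv : 1 ≤ v) :
    fFun 1 (a, v) (b, 1) = max a b := by
  unfold fFun
  split_ifs with h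
  · simp_all
  · simp [le_of_not_ge h, zero_le_one.trans hv]

theorem fFun_one_right (a b v : ℝ) (hv : 1 ≤ v) :
    fFun 1 (a, 1) (b, v) = max a b := by
  unfold fFun
  split_ifs with h
  · simp_all [zero_le_one.trans hv]
  · simp_all [le_of_not_ge h]

theorem fFun_one_zero (a b : ℝ) : fFun 1 (a, 1) (b, 0) = a := by
  unfold fFun
  split_ifs <;> simp

theorem fFun_two (a b : ℝ) : fFun 2 (a, 1) (b, 1) = a + b := by
  unfold fFun
  split_ifs <;> norm_num [add_comm]

theorem gFun_one_zero (a b c : ℝ) : gFun 1 (a, 2) (b, 1) (c, 0) = max a b := by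
  unfold gFun gAux
  dsimp only
  split_ifs <;> norm_num <;> grind

theorem gFun_one (a b c : ℝ) : gFun 1 (a, 1) (b, 1) (c, 1) = max (max a b) c := by
  unfold gFun gAux
  dsimp only
  split_ifs <;> norm_num <;> grind

/-- The diagonal of the region of the `(1,1,2,1)` channel is an interval. -/
theorem diagonal_GDoF_1121 (α : ℝ) (hα : 0 ≤ α) :
    { d : ℝ | 0 ≤ d ∧ (d, d) ∈ GDoF 1 1 2 1 α α 1 } =
      Set.Icc 0 (min 1 ((max α 1 + max (1 - α) 0) / 2)) := by
  ext d
  simp only [GDoF, Set.mem_ofPred_eq, Set.mem_Icc, Nat.cast_one, Nat.cast_ofNat]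
  norm_num only [min_self, sub_self, max_self, min_eq_left, min_eq_right, max_eq_left,
    fFun_one_left, fFun_one_right, fFun_one_zero, fFun_two, gFun_one_zero, gFun_one, le_min_iff]
  have hβ : max (1 - α) 0 ≤ 1 := max_le (by linarith) zero_le_one
  rw [max_eq_right hβ]
  have h₁ := le_max_left α (max (1 - α) 0)
  have h₂ := le_max_right α (max (1 - α) 0)
  have h₃ := le_max_left (1 - α) 0
  have h₄ := le_max_right (max α (max (1 - α) 0)) 1
  have h₅ := le_max_left (max α (max (1 - α) 0)) 1
  have h₆ : max α 1 ≤ max (max α (max (1 - α) 0)) 1 := max_le_max_right 1 h₁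
  constructor
  · rintro ⟨hd, -, -, hd₁, -, h, -⟩
    exact ⟨hd, hd₁, by linarith⟩
  · rintro ⟨hd, hd₁, h⟩
    have h₇ := le_max_right α 1
    refine ⟨hd, hd, hd, hd₁, hd₁, ?_, ?_, ?_, ?_, ?_⟩ <;> linarith

theorem dsym_1121_eq (α : ℝ) (hα : 0 ≤ α) :
    dsym 1 1 2 1 α α 1 = min 1 ((max α 1 + max (1 - α) 0) / 2) := by
  rw [dsym, diagonal_GDoF_1121 α hα]
  exact csSup_Icc (by positivity)

/-- the "V"-shaped symmetric GDoF of the `(1,1,2,1)` channel. -/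
theorem dsym_1121_V (α : ℝ) (hα : 0 ≤ α) :
    (α ≤ 1 → dsym 1 1 2 1 α α 1 = 1 - α / 2) ∧
    (1 ≤ α → α ≤ 2 → dsym 1 1 2 1 α α 1 = α / 2) ∧
    (2 ≤ α → dsym 1 1 2 1 α α 1 = 1) := by
  rw [dsym_1121_eq α hα]
  refine ⟨fun h => ?_, fun h h' => ?_, fun h => ?_⟩ <;> grind
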